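/- If C is an object of D^-(mod Λ) (the bounded-above derived category of finite-dimensional Λ-modules) such that Hom(C, Σ^m T_i)=0 for all integers m and all 1 ≤ i ≤ r, then C = 0. -/

import Mathlib

open CategoryTheory Limits Pretriangulated ZeroObject

noncomputable section

namespace RickardKoenigYang

universe w v u

variable (K : Type) [Field K] [IsAlgClosed K]
variable (Λ : Type) [Ring Λ] [Algebra K Λ] [FiniteDimensional K Λ]

/-- `Λ` is a basic algebra (over the algebraically closed field `K`): every simple
`Λ`-module is one-dimensional over `K`. -/
def IsBasicAlgebra : Prop :=
  ∀ (M : Type) [AddCommGroup M] [Module K M] [Module Λ M] [IsScalarTower K Λ M],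
    IsSimpleModule Λ M → Module.finrank K M = 1

/-- A complete family of `r` pairwise non-isomorphic simple `Λ`-modules; this expresses
that `r` is the rank of the Grothendieck group of `mod Λ`. -/
def IsCompleteFamilyOfSimples (r : ℕ) : Prop :=
  ∃ S : Fin r → ModuleCat.{0} Λ,
    (∀ i, IsSimpleModule Λ (S i)) ∧
    (∀ i j, i ≠ j → IsEmpty (S i ≅ S j)) ∧
    (∀ M : ModuleCat.{0} Λ, IsSimpleModule Λ M → ∃ i, Nonempty (M ≅ S i))

section Thick

variable {C : Type u} [Category.{v} C] [Preadditive C] [HasZeroObject C] [HasShift C ℤ]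
  [∀ n : ℤ, (shiftFunctor C n).Additive] [Pretriangulated C]

/-- Membership in the thick (= épaisse) triangulated subcategory generated by a set `S`
of objects: the closure of `S` under isomorphisms, shifts, extensions
(cones of morphisms) and direct summands. -/
inductive ThickMem (S : Set C) : C → Prop
  | of (X : C) (hX : X ∈ S) : ThickMem S X
  | zero : ThickMem S 0
  | iso {X Y : C} (e : X ≅ Y) (hX : ThickMem S X) : ThickMem S Y
  | shift (X : C) (n : ℤ) (hX : ThickMem S X) : ThickMem S (X⟦n⟧)
  | ext (T : Triangle C) (hT : T ∈ distTriang C) (h₁ : ThickMem S T.obj₁)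
      (h₃ : ThickMem S T.obj₃) : ThickMem S T.obj₂
  | summand {X Y : C} (i : X ⟶ Y) (p : Y ⟶ X) (hip : i ≫ p = 𝟙 X) (hY : ThickMem S Y) :
      ThickMem S X

end Thick

variable [HasDerivedCategory (ModuleCat.{0} Λ)]

/-- An object of `D(Mod Λ)` belongs to `D^b(mod Λ)`: it is isomorphic to a bounded
complex of finitely generated `Λ`-modules. -/
def IsDbObject (C : DerivedCategory (ModuleCat.{0} Λ)) : Prop :=
  ∃ M : CochainComplex (ModuleCat.{0} Λ) ℤ,
    (∃ a b : ℤ, ∀ n : ℤ, (n < a ∨ b < n) → IsZero (M.X n)) ∧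
    (∀ n : ℤ, Module.Finite Λ (M.X n)) ∧
    Nonempty (DerivedCategory.Q.obj M ≅ C)

variable [CategoryTheory.Linear K (DerivedCategory (ModuleCat.{0} Λ))]
  [(DerivedCategory.Qh (C := ModuleCat.{0} Λ)).Linear K]

/-- A simple-minded collection `X_1, …, X_r` in `D^b(mod Λ) ⊆ D(Mod Λ)`. -/
structure IsSimpleMindedCollection (r : ℕ) (X : Fin r → DerivedCategory (ModuleCat.{0} Λ)) :
    Prop where
  mem_Db : ∀ i, IsDbObject Λ (X i)
  hom_neg_shift_vanish : ∀ i j (m : ℤ), m < 0 → ∀ f : X i ⟶ (X j)⟦m⟧, f = 0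
  end_dim : ∀ i, Module.finrank K (X i ⟶ X i) = 1
  hom_ne_vanish : ∀ i j, i ≠ j → ∀ f : X i ⟶ X j, f = 0
  generates : ∀ C : DerivedCategory (ModuleCat.{0} Λ), IsDbObject Λ C ↔ ThickMem (Set.range X) C

variable {Λ}

/-- The data of Rickard's construction of the objects `T_1, …, T_r` from a collection
`X_1, …, X_r`: the sequences `X_i = X_i⁽⁰⁾ → X_i⁽¹⁾ → ⋯`, where `X_i⁽ⁿ⁺¹⁾` is a cone of
the canonical map `Z_i⁽ⁿ⁾ = ⊕_{m<0} ⊕_j ⊕_{B(j,m,i,n)} Σ^m X_j → X_i⁽ⁿ⁾` whose component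
corresponding to a basis vector `f ∈ B(j,m,i,n)` of `Hom(Σ^m X_j, X_i⁽ⁿ⁾)` is `f` itself,
and `T_i` is the Milnor colimit of the sequence. -/
structure RickardData (r : ℕ) (X : Fin r → DerivedCategory (ModuleCat.{0} Λ)) where
  /-- the objects `X_i⁽ⁿ⁾` -/
  Xs : Fin r → ℕ → DerivedCategory (ModuleCat.{0} Λ)
  Xs_zero : ∀ i, Xs i 0 = X i
  /-- `B j m i n` is a chosen basis of `Hom(Σ^m X_j, X_i⁽ⁿ⁾)` (for `m < 0`) -/
  B : ∀ (j : Fin r) (m : ℤ) (i : Fin r) (n : ℕ), Set ((X j)⟦m⟧ ⟶ Xs i n)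
  B_indep : ∀ j m i n, m < 0 →
    LinearIndependent K (fun f : B j m i n => (f : (X j)⟦m⟧ ⟶ Xs i n))
  B_span : ∀ j m i n, m < 0 → Submodule.span K (B j m i n) = ⊤
  /-- the objects `Z_i⁽ⁿ⁾` -/
  Z : Fin r → ℕ → DerivedCategory (ModuleCat.{0} Λ)
  /-- the coproduct inclusions into `Z_i⁽ⁿ⁾` -/
  inc : ∀ (i : Fin r) (n : ℕ)
      (p : Σ (j : Fin r) (m : ℤ), {f : (X j)⟦m⟧ ⟶ Xs i n // m < 0 ∧ f ∈ B j m i n}),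
      (X p.1)⟦p.2.1⟧ ⟶ Z i n
  isColimitZ : ∀ i n, Nonempty (IsColimit (Cofan.mk (Z i n) (inc i n)))
  /-- the canonical morphism `α_i⁽ⁿ⁾ : Z_i⁽ⁿ⁾ → X_i⁽ⁿ⁾` -/
  α : ∀ i n, Z i n ⟶ Xs i n
  inc_α : ∀ i n p, inc i n p ≫ α i n = p.2.2.1
  /-- the morphisms `β_i⁽ⁿ⁾ : X_i⁽ⁿ⁾ → X_i⁽ⁿ⁺¹⁾` -/
  β : ∀ i n, Xs i n ⟶ Xs i (n + 1)
  γ : ∀ i n, Xs i (n + 1) ⟶ (Z i n)⟦(1 : ℤ)⟧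
  dist : ∀ i n, Triangle.mk (α i n) (β i n) (γ i n) ∈ distTriang (DerivedCategory (ModuleCat.{0} Λ))
  /-- the objects `T_i` -/
  T : Fin r → DerivedCategory (ModuleCat.{0} Λ)
  /-- the coproducts `⊕_{n ≥ 0} X_i⁽ⁿ⁾` -/
  CP : Fin r → DerivedCategory (ModuleCat.{0} Λ)
  cinc : ∀ (i : Fin r) (n : ℕ), Xs i n ⟶ CP i
  isColimitCP : ∀ i, Nonempty (IsColimit (Cofan.mk (CP i) (cinc i)))
  /-- the morphism `id - β : ⊕ X_i⁽ⁿ⁾ → ⊕ X_i⁽ⁿ⁾` -/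
  oneSubβ : ∀ i, CP i ⟶ CP i
  cinc_oneSubβ : ∀ i n, cinc i n ≫ oneSubβ i = cinc i n - β i n ≫ cinc i (n + 1)
  toT : ∀ i, CP i ⟶ T i
  δT : ∀ i, T i ⟶ (CP i)⟦(1 : ℤ)⟧
  distT : ∀ i, Triangle.mk (oneSubβ i) (toT i) (δT i) ∈
    distTriang (DerivedCategory (ModuleCat.{0} Λ))

end RickardKoenigYang

namespace RickardKoenigYang

/-- An object of `D(Mod Λ)` belongs to `D^-(mod Λ)`: it is isomorphic to a bounded above
complex of finitely generated `Λ`-modules. -/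
def IsDminusObject (Λ : Type) [Ring Λ] [HasDerivedCategory (ModuleCat.{0} Λ)]
    (C : DerivedCategory (ModuleCat.{0} Λ)) : Prop :=
  ∃ M : CochainComplex (ModuleCat.{0} Λ) ℤ,
    (∃ b : ℤ, ∀ n : ℤ, b < n → IsZero (M.X n)) ∧
    (∀ n : ℤ, Module.Finite Λ (M.X n)) ∧
    Nonempty (DerivedCategory.Q.obj M ≅ C)

section Coproducts

variable {Λ : Type} [Ring Λ] {J : Type}

/-- A family of complexes of modules, seen as a complex of families of modules. -/
@[simps]
def familyComplex (M : J → CochainComplex (ModuleCat.{0} Λ) ℤ) :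
    CochainComplex (Discrete J ⥤ ModuleCat.{0} Λ) ℤ where
  X i := Discrete.functor fun j => (M j).X i
  d i k := Discrete.natTrans fun j => (M j.as).d i k
  shape i k h := by ext j : 2; exact (M j.as).shape i k h
  d_comp_d' i k l _ _ := by ext j : 2; exact (M j.as).d_comp_d i k l

/-- The morphism of complexes of families attached to a family of morphisms of complexes. -/
@[simps]
def familyMap {M N : J → CochainComplex (ModuleCat.{0} Λ) ℤ} (φ : ∀ j, M j ⟶ N j) :
    familyComplex M ⟶ familyComplex N where
  f i := Discrete.natTrans fun j => (φ j.as).f i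
  comm' i k _ := by ext j : 2; exact (φ j.as).comm i k

lemma quasiIso_familyMap {M N : J → CochainComplex (ModuleCat.{0} Λ) ℤ} (φ : ∀ j, M j ⟶ N j)
    (hφ : ∀ j, QuasiIso (φ j)) : QuasiIso (familyMap φ) := by
  rw [HomologicalComplex.quasiIso_iff_evaluation]
  exact fun j => hφ j.as

/-- The termwise direct sum of a family of complexes of modules. -/
def sumComplex (M : J → CochainComplex (ModuleCat.{0} Λ) ℤ) :
    CochainComplex (ModuleCat.{0} Λ) ℤ :=
  ((colim (J := Discrete J)).mapHomologicalComplex _).obj (familyComplex M)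

/-- The inclusion of a summand in the termwise direct sum. -/
def sumι (M : J → CochainComplex (ModuleCat.{0} Λ) ℤ) (j : J) : M j ⟶ sumComplex M where
  f i := colimit.ι ((familyComplex M).X i) ⟨j⟩
  comm' i k _ := ι_colimMap ((familyComplex M).d i k) ⟨j⟩

/-- The cocone in a fixed degree attached to a family of morphisms to a fixed complex. -/
def sumCocone {M : J → CochainComplex (ModuleCat.{0} Λ) ℤ}
    {N : CochainComplex (ModuleCat.{0} Λ) ℤ} (φ : ∀ j, M j ⟶ N) (i : ℤ) :
    Cocone ((familyComplex M).X i) :=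
  ⟨N.X i, Discrete.natTrans fun j => (φ j.as).f i⟩

/-- The morphism from the termwise direct sum induced by a family of morphisms. -/
def sumDesc {M : J → CochainComplex (ModuleCat.{0} Λ) ℤ} {N : CochainComplex (ModuleCat.{0} Λ) ℤ}
    (φ : ∀ j, M j ⟶ N) : sumComplex M ⟶ N where
  f i := colimit.desc ((familyComplex M).X i) (sumCocone φ i)
  comm' i k _ := by
    apply colimit.hom_ext
    rintro ⟨j⟩
    refine (colimit.ι_desc_assoc _ _ _).trans (Eq.trans ?_
      (ι_colimMap_assoc ((familyComplex M).d i k) ⟨j⟩ _).symm)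
    exact ((φ j).comm i k).trans (congrArg ((M j).d i k ≫ ·) (colimit.ι_desc (sumCocone φ k) ⟨j⟩).symm)

lemma sumι_desc {M : J → CochainComplex (ModuleCat.{0} Λ) ℤ}
    {N : CochainComplex (ModuleCat.{0} Λ) ℤ} (φ : ∀ j, M j ⟶ N) (j : J) :
    sumι M j ≫ sumDesc φ = φ j := by
  ext i : 1
  exact colimit.ι_desc _ _

/-- The morphism between termwise direct sums induced by a family of morphisms. -/
def sumMap {M N : J → CochainComplex (ModuleCat.{0} Λ) ℤ} (φ : ∀ j, M j ⟶ N j) :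
    sumComplex M ⟶ sumComplex N :=
  ((colim (J := Discrete J)).mapHomologicalComplex _).map (familyMap φ)

lemma sumι_map {M N : J → CochainComplex (ModuleCat.{0} Λ) ℤ} (φ : ∀ j, M j ⟶ N j) (j : J) :
    sumι M j ≫ sumMap φ = φ j ≫ sumι N j := by
  ext i : 1
  exact ι_colimMap ((familyMap φ).f i) ⟨j⟩

lemma quasiIso_sumMap {M N : J → CochainComplex (ModuleCat.{0} Λ) ℤ} (φ : ∀ j, M j ⟶ N j)
    (hφ : ∀ j, QuasiIso (φ j)) : QuasiIso (sumMap φ) := by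
  have := quasiIso_familyMap φ hφ
  exact HomologicalComplex.quasiIso_map_of_preservesHomology _ _

lemma isStrictlyGE_sumComplex (M : J → CochainComplex (ModuleCat.{0} Λ) ℤ) (n : ℤ)
    (hM : ∀ j, (M j).IsStrictlyGE n) : (sumComplex M).IsStrictlyGE n := by
  rw [CochainComplex.isStrictlyGE_iff]
  intro i hi
  rw [IsZero.iff_id_eq_zero]
  apply colimit.hom_ext
  rintro ⟨j⟩
  exact ((M j).isZero_of_isStrictlyGE n i hi).eq_of_src _ _

lemma exists_sum_sumι (M : J → CochainComplex (ModuleCat.{0} Λ) ℤ) (i : ℤ)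
    (x : (sumComplex M).X i) :
    ∃ (F : Finset J) (y : ∀ j, (M j).X i), x = ∑ j ∈ F, (sumι M j).f i (y j) := by
  classical
  set p : Submodule Λ ((sumComplex M).X i) := ⨆ j, LinearMap.range ((sumι M j).f i).hom with hp
  have hmk : ModuleCat.ofHom p.mkQ = 0 := by
    apply colimit.hom_ext
    rintro ⟨j⟩
    ext y
    refine (Submodule.Quotient.mk_eq_zero p).2 ?_
    exact Submodule.mem_iSup_of_mem j ⟨y, rfl⟩
  have hx : x ∈ p := (Submodule.Quotient.mk_eq_zero p).1
    (congrArg (fun f => (ModuleCat.Hom.hom f) x) hmk)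
  rw [hp] at hx
  obtain ⟨f, hf⟩ := (Submodule.mem_iSup_iff_exists_finsupp _ _).1 hx
  choose y hy using hf.1
  exact ⟨f.support, y, by simp only [hy]; exact hf.2.symm⟩

open Classical in
/-- The projection of the termwise direct sum onto a summand. -/
def sumπ (M : J → CochainComplex (ModuleCat.{0} Λ) ℤ) (k : J) : sumComplex M ⟶ M k :=
  sumDesc fun j => if h : j = k then eqToHom (by rw [h]) else 0

lemma sumι_π_self (M : J → CochainComplex (ModuleCat.{0} Λ) ℤ) (j : J) :
    sumι M j ≫ sumπ M j = 𝟙 _ := by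
  simp [sumπ, sumι_desc]

lemma sumι_π_of_ne (M : J → CochainComplex (ModuleCat.{0} Λ) ℤ) {j k : J} (h : j ≠ k) :
    sumι M j ≫ sumπ M k = 0 := by
  simp [sumπ, sumι_desc, h]

lemma exists_sum_sumπ_sumι_apply (M : J → CochainComplex (ModuleCat.{0} Λ) ℤ) (i : ℤ)
    (x : (sumComplex M).X i) :
    ∃ F : Finset J, ∀ G : Finset J, F ⊆ G → (∑ k ∈ G, sumπ M k ≫ sumι M k).f i x = x := by
  classical
  obtain ⟨F, y, rfl⟩ := exists_sum_sumι M i x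
  refine ⟨F, fun G hG => ?_⟩
  rw [map_sum]
  refine Finset.sum_congr rfl fun j hj => ?_
  have : sumι M j ≫ ∑ k ∈ G, sumπ M k ≫ sumι M k = sumι M j := by
    rw [Preadditive.comp_sum, Finset.sum_eq_single j]
    · rw [← Category.assoc, sumι_π_self, Category.id_comp]
    · intro k _ hk
      rw [← Category.assoc, sumι_π_of_ne M hk.symm, zero_comp]
    · exact fun h => absurd (hG hj) h
  exact congrArg (fun f => f.f i (y j)) this

end Coproducts

section Compact

universe w

variable {Λ : Type} [Ring Λ] [HasDerivedCategory.{w} (ModuleCat.{0} Λ)]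

open DerivedCategory

lemma exists_desc_sumComplex {J : Type} (M : J → CochainComplex (ModuleCat.{0} Λ) ℤ)
    (Z : DerivedCategory (ModuleCat.{0} Λ)) (inc : ∀ j, Q.obj (M j) ⟶ Z) :
    ∃ t : Q.obj (sumComplex M) ⟶ Z, ∀ j, Q.map (sumι M j) ≫ t = inc j := by
  obtain ⟨N, ⟨e⟩⟩ : ∃ N, Nonempty (Q.obj N ≅ Z) := ⟨_, ⟨Q.objObjPreimageIso Z⟩⟩
  choose M' s hs g hg using fun j => right_fac (inc j ≫ e.inv)
  have : IsIso (Q.map (sumMap s)) := by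
    rw [isIso_Q_map_iff_quasiIso]
    exact quasiIso_sumMap s fun j => (isIso_Q_map_iff_quasiIso _ _).1 (hs j)
  refine ⟨inv (Q.map (sumMap s)) ≫ Q.map (sumDesc g) ≫ e.hom, fun j => ?_⟩
  rw [← cancel_epi (Q.map (s j)), ← Q.map_comp_assoc, ← sumι_map, Q.map_comp_assoc,
    IsIso.hom_inv_id_assoc, ← Q.map_comp_assoc, sumι_desc, ← cancel_mono e.inv]
  simp [hg]

/-- A coproduct in the derived category is a retract of the direct sum of representing
complexes. -/
lemma exists_retract_sumComplex {J : Type} (Y : J → DerivedCategory (ModuleCat.{0} Λ)) (n : ℤ)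
    (hY : ∀ j, (Y j).IsGE n) (Z : DerivedCategory (ModuleCat.{0} Λ)) (inc : ∀ j, Y j ⟶ Z)
    (hZ : IsColimit (Cofan.mk Z inc)) :
    ∃ (M : J → CochainComplex (ModuleCat.{0} Λ) ℤ) (_ : ∀ j, (M j).IsStrictlyGE n)
      (e : ∀ j, Y j ≅ Q.obj (M j)) (s : Z ⟶ Q.obj (sumComplex M))
      (t : Q.obj (sumComplex M) ⟶ Z), s ≫ t = 𝟙 Z ∧
        ∀ j, Q.map (sumι M j) ≫ t = (e j).inv ≫ inc j := by
  choose M hM e using fun j => (Y j).exists_iso_Q_obj_of_isGE n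
  replace e := fun j => (e j).some
  obtain ⟨t, ht⟩ := exists_desc_sumComplex M Z fun j => (e j).inv ≫ inc j
  refine ⟨M, hM, e, Cofan.IsColimit.desc hZ fun j => (e j).hom ≫ Q.map (sumι M j), t, ?_, ht⟩
  refine Cofan.IsColimit.hom_ext hZ _ _ fun j => ?_
  rw [Cofan.IsColimit.fac_assoc, Category.assoc, ht, Iso.hom_inv_id_assoc]
  exact (Category.comp_id _).symm

lemma isGE_of_isColimit {J : Type} (Y : J → DerivedCategory (ModuleCat.{0} Λ)) (n : ℤ)
    (hY : ∀ j, (Y j).IsGE n) (Z : DerivedCategory (ModuleCat.{0} Λ)) (inc : ∀ j, Y j ⟶ Z)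
    (hZ : IsColimit (Cofan.mk Z inc)) : Z.IsGE n := by
  obtain ⟨M, hM, -, s, t, hst, -⟩ := exists_retract_sumComplex Y n hY Z inc hZ
  have := isStrictlyGE_sumComplex M n hM
  rw [isGE_iff]
  intro i hi
  have hz := isZero_of_isGE (Q.obj (sumComplex M)) n i hi
  rw [IsZero.iff_id_eq_zero] at hz ⊢
  rw [← CategoryTheory.Functor.map_id, ← hst, Functor.map_comp,
    ← Category.id_comp ((homologyFunctor _ i).map t), hz, zero_comp, comp_zero]

/-- `C` is compact with respect to objects of the derived category that are `≥ n`. -/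
structure IsCompactGE (C : DerivedCategory (ModuleCat.{0} Λ)) (n : ℤ) : Prop where
  small : ∀ Y : DerivedCategory (ModuleCat.{0} Λ), Y.IsGE n → Small.{0} (C ⟶ Y)
  exists_sum : ∀ {J : Type} (Y : J → DerivedCategory (ModuleCat.{0} Λ))
    (Z : DerivedCategory (ModuleCat.{0} Λ)) (inc : ∀ j, Y j ⟶ Z),
    IsColimit (Cofan.mk Z inc) → (∀ j, (Y j).IsGE n) → ∀ f : C ⟶ Z,
      ∃ (F : Finset J) (g : ∀ j, C ⟶ Y j), f = ∑ j ∈ F, g j ≫ inc j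

lemma isCompactGE_of_isLE (C : DerivedCategory (ModuleCat.{0} Λ)) (b n : ℤ) (hbn : b < n)
    [C.IsLE b] : IsCompactGE C n where
  small Y hY := by
    have : Subsingleton (C ⟶ Y) :=
      ⟨fun f g => (TStructure.t.zero f b n hbn).trans (TStructure.t.zero g b n hbn).symm⟩
    infer_instance
  exists_sum Y Z inc hZ hY f := by
    have := isGE_of_isColimit Y n hY Z inc hZ
    exact ⟨∅, fun _ => 0, by simpa using TStructure.t.zero f b n hbn⟩

lemma IsCompactGE.of_iso {C C' : DerivedCategory (ModuleCat.{0} Λ)} {n : ℤ}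
    (h : IsCompactGE C n) (e : C ≅ C') : IsCompactGE C' n where
  small Y hY := by
    have := h.small Y hY
    exact small_of_injective (β := C ⟶ Y) (f := fun f => e.hom ≫ f)
      fun f g hfg => (cancel_epi e.hom).1 hfg
  exists_sum Y Z inc hZ hY f := by
    obtain ⟨F, g, hg⟩ := h.exists_sum Y Z inc hZ hY (e.hom ≫ f)
    exact ⟨F, fun j => e.inv ≫ g j, by
      simp only [Category.assoc, ← Preadditive.comp_sum, ← hg, Iso.inv_hom_id_assoc]⟩

lemma eq_zero_of_sum_comp_eq_zero {J : Type} {D : Type*} [Category* D] [Preadditive D]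
    {Y : J → D} {Z A : D} (inc : ∀ j, Y j ⟶ Z) (hZ : IsColimit (Cofan.mk Z inc))
    (F : Finset J) (g : ∀ j, A ⟶ Y j) (h : ∑ j ∈ F, g j ≫ inc j = 0) {k : J} (hk : k ∈ F) :
    g k = 0 := by
  classical
  let p : Z ⟶ Y k := Cofan.IsColimit.desc hZ fun j =>
    if hjk : j = k then eqToHom (by rw [hjk]) else 0
  have hp (j : J) : inc j ≫ p = if hjk : j = k then eqToHom (by rw [hjk]) else 0 :=
    Cofan.IsColimit.fac hZ _ j
  have := congrArg (· ≫ p) h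
  simp only [Preadditive.sum_comp, Category.assoc, hp, zero_comp] at this
  rw [Finset.sum_eq_single k (fun j _ hjk => by simp [hjk]) (fun hk' => absurd hk hk')] at this
  simpa using this

lemma exists_weak_cokernel (T : Triangle (DerivedCategory (ModuleCat.{0} Λ)))
    (hT : T ∈ distTriang (DerivedCategory (ModuleCat.{0} Λ))) :
    ∃ (W : DerivedCategory (ModuleCat.{0} Λ)) (δ : W ⟶ T.obj₁), δ ≫ T.mor₁ = 0 ∧
      ∀ {Y : DerivedCategory (ModuleCat.{0} Λ)} (a : T.obj₁ ⟶ Y), δ ≫ a = 0 →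
        ∃ b, a = T.mor₁ ≫ b :=
  have hT' := inv_rot_of_distTriang _ hT
  ⟨_, T.invRotate.mor₁, comp_distTriang_mor_zero₁₂ _ hT',
    fun a ha => T.invRotate.yoneda_exact₂ hT' a ha⟩

lemma IsCompactGE.of_distinguished (T : Triangle (DerivedCategory (ModuleCat.{0} Λ)))
    (hT : T ∈ distTriang (DerivedCategory (ModuleCat.{0} Λ))) (n : ℤ)
    (h₁ : IsCompactGE T.obj₁ n) (h₃ : IsCompactGE T.obj₃ n) : IsCompactGE T.obj₂ n where
  small Y hY := by
    have := h₁.small Y hY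
    have := h₃.small Y hY
    let s : Set.range (fun f : T.obj₂ ⟶ Y => T.mor₁ ≫ f) → (T.obj₂ ⟶ Y) := fun a => a.2.choose
    have hs (a) : T.mor₁ ≫ s a = a.1 := a.2.choose_spec
    refine small_of_surjective
      (f := fun p : (T.obj₃ ⟶ Y) × Set.range (fun f : T.obj₂ ⟶ Y => T.mor₁ ≫ f) =>
        T.mor₂ ≫ p.1 + s p.2) fun f => ?_
    obtain ⟨g, hg⟩ := T.yoneda_exact₂ hT (f - s ⟨_, f, rfl⟩) (by
      rw [Preadditive.comp_sub, hs, sub_self])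
    exact ⟨⟨g, _, f, rfl⟩, by dsimp only; rw [← hg, sub_add_cancel]⟩
  exists_sum {J} Y Z inc hZ hY f := by
    classical
    obtain ⟨F, a, ha⟩ := h₁.exists_sum Y Z inc hZ hY (T.mor₁ ≫ f)
    obtain ⟨W, δ, hδ, hδ'⟩ := exists_weak_cokernel T hT
    have key (k : J) (hk : k ∈ F) : δ ≫ a k = 0 :=
      eq_zero_of_sum_comp_eq_zero inc hZ F (fun j => δ ≫ a j) (by
        simp only [Category.assoc]
        rw [← Preadditive.comp_sum, ← ha, reassoc_of% hδ, zero_comp]) hk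
    have key' (k : J) : ∃ b : T.obj₂ ⟶ Y k, k ∈ F → a k = T.mor₁ ≫ b := by
      by_cases hk : k ∈ F
      · obtain ⟨b, hb⟩ := hδ' (a k) (key k hk)
        exact ⟨b, fun _ => hb⟩
      · exact ⟨0, fun h => absurd h hk⟩
    choose b hb using key'
    obtain ⟨g, hg⟩ := T.yoneda_exact₂ hT (f - ∑ j ∈ F, b j ≫ inc j) (by
      rw [Preadditive.comp_sub, ha, Preadditive.comp_sum, sub_eq_zero]
      exact Finset.sum_congr rfl fun j hj => by rw [hb j hj, Category.assoc])
    obtain ⟨G, c, hc⟩ := h₃.exists_sum Y Z inc hZ hY g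
    refine ⟨F ∪ G, fun j => (if j ∈ F then b j else 0) + (if j ∈ G then T.mor₂ ≫ c j else 0), ?_⟩
    rw [← sub_add_cancel f (∑ j ∈ F, b j ≫ inc j), hg, hc]
    simp only [Preadditive.add_comp, Finset.sum_add_distrib, ite_comp, zero_comp]
    rw [← Finset.sum_filter, ← Finset.sum_filter, add_comm, Preadditive.comp_sum]
    congr 1
    · exact Finset.sum_congr (by ext; simp) fun _ _ => rfl
    · exact Finset.sum_congr (by ext; simp) fun _ _ => (Category.assoc _ _ _).symm

lemma exists_Q_map_eq_of_isKProjective (P L : CochainComplex (ModuleCat.{0} Λ) ℤ)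
    [P.IsKProjective] (f : Q.obj P ⟶ Q.obj L) : ∃ φ : P ⟶ L, Q.map φ = f := by
  obtain ⟨g, hg⟩ := (CochainComplex.IsKProjective.Qh_map_bijective P
    ((HomotopyCategory.quotient _ _).obj L)).surjective
      ((quotientCompQhIso _).hom.app P ≫ f ≫ (quotientCompQhIso _).inv.app L)
  obtain ⟨φ, rfl⟩ := (HomotopyCategory.quotient _ _).map_surjective g
  refine ⟨φ, ?_⟩
  have := (quotientCompQhIso (ModuleCat.{0} Λ)).hom.naturality φ
  rw [← cancel_epi ((quotientCompQhIso _).hom.app P), ← this]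
  dsimp
  rw [hg]
  simp

instance isKProjective_single (P : ModuleCat.{0} Λ) [Projective P] (k : ℤ) :
    ((CochainComplex.singleFunctor (ModuleCat.{0} Λ) k).obj P).IsKProjective := by
  have (n : ℤ) : Projective (((CochainComplex.singleFunctor (ModuleCat.{0} Λ) k).obj P).X n) := by
    by_cases h : n = k
    · subst h
      exact Projective.of_iso (HomologicalComplex.singleObjXSelf (ComplexShape.up ℤ) n P).symm
        inferInstance
    · exact (HomologicalComplex.isZero_single_obj_X _ _ _ _ h).projective
  exact CochainComplex.isKProjective_of_projective _ k

lemma isCompactGE_single_of_projective (P : ModuleCat.{0} Λ) [Projective P] [Module.Finite Λ P]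
    (k n : ℤ) :
    IsCompactGE (Q.obj ((CochainComplex.singleFunctor (ModuleCat.{0} Λ) k).obj P)) n where
  small Y hY := by
    obtain ⟨N, -, ⟨e⟩⟩ := Y.exists_iso_Q_obj_of_isGE n
    refine small_of_surjective
      (f := fun φ : (CochainComplex.singleFunctor (ModuleCat.{0} Λ) k).obj P ⟶ N =>
        Q.map φ ≫ e.inv) fun f => ?_
    obtain ⟨φ, hφ⟩ := exists_Q_map_eq_of_isKProjective _ _ (f ≫ e.hom)
    exact ⟨φ, by simp [hφ]⟩
  exists_sum {J} Y Z inc hZ hY f := by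
    classical
    obtain ⟨M, hM, e, s, t, hst, ht⟩ := exists_retract_sumComplex Y n hY Z inc hZ
    obtain ⟨φ, hφ⟩ := exists_Q_map_eq_of_isKProjective _ _ (f ≫ s)
    let i := HomologicalComplex.singleObjXSelf (ComplexShape.up ℤ) k P
    obtain ⟨S, hS⟩ := Module.Finite.fg_top (R := Λ) (M := P)
    choose F hF using fun x : P => exists_sum_sumπ_sumι_apply M k ((i.inv ≫ φ.f k) x)
    have hφ' : φ = φ ≫ ∑ j ∈ S.biUnion F, sumπ M j ≫ sumι M j := by
      apply HomologicalComplex.from_single_hom_ext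
      rw [← cancel_epi i.inv]
      ext x
      induction (show x ∈ Submodule.span Λ (S : Set P) from hS ▸ Submodule.mem_top)
        using Submodule.span_induction with
      | mem x hx => exact (hF x _ (Finset.subset_biUnion_of_mem F hx)).symm
      | zero => simp only [map_zero]
      | add x y _ _ hx hy => simp only [map_add, hx, hy]
      | smul a x _ hx => simp only [map_smul, hx]
    refine ⟨S.biUnion F, fun j => Q.map (φ ≫ sumπ M j) ≫ (e j).inv, ?_⟩
    have hf : f = Q.map φ ≫ t := by rw [hφ, Category.assoc, hst, Category.comp_id]
    refine hf.trans ((congrArg (fun ψ => Q.map ψ ≫ t) hφ').trans ?_)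
    simp only [Preadditive.comp_sum, Functor.map_sum, Preadditive.sum_comp]
    refine Finset.sum_congr rfl fun j _ => ?_
    rw [Category.assoc, ← ht]
    simp only [Functor.map_comp, Category.assoc]

lemma isCompactGE_single [IsNoetherianRing Λ] (A : ModuleCat.{0} Λ) [Module.Finite Λ A]
    (k n : ℤ) : IsCompactGE (Q.obj ((CochainComplex.singleFunctor (ModuleCat.{0} Λ) k).obj A)) n := by
  obtain ⟨d, hd⟩ : ∃ d : ℕ, k - n < d := ⟨(k - n + 1).toNat, by lia⟩
  induction d generalizing A k with
  | zero => exact isCompactGE_of_isLE _ k n (by simpa using hd)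
  | succ d ih =>
    obtain ⟨m, f, hf⟩ := Module.Finite.exists_fin' Λ A
    have hS := (LinearMap.shortExact_shortComplexKer hf).map_of_exact
      (HomologicalComplex.single (ModuleCat.{0} Λ) (ComplexShape.up ℤ) k)
    have : Projective (ModuleCat.of Λ (Fin m → Λ)) := ModuleCat.projective_of_free (Pi.basisFun Λ _)
    exact IsCompactGE.of_distinguished _ (rot_of_distTriang _ (triangleOfSES_distinguished hS)) n
      (isCompactGE_single_of_projective (ModuleCat.of Λ (Fin m → Λ)) k n)
      ((ih (ModuleCat.of Λ (LinearMap.ker f)) (k - 1) (by push_cast at hd; lia)).of_iso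
        (((singleFunctors _).shiftIso 1 (k - 1) k (by lia)).app _).symm)

lemma isCompactGE_of_isStrictlyLE [IsNoetherianRing Λ] (M : CochainComplex (ModuleCat.{0} Λ) ℤ)
    (hM : ∀ i, Module.Finite Λ (M.X i)) (b n : ℤ) (hb : M.IsStrictlyLE b) :
    IsCompactGE (Q.obj M) n := by
  obtain ⟨d, hd⟩ : ∃ d : ℕ, b - n < d := ⟨(b - n + 1).toNat, by lia⟩
  induction d generalizing M b with
  | zero => exact isCompactGE_of_isLE _ b n (by simpa using hd)
  | succ d ih =>
    let ι : (CochainComplex.singleFunctor (ModuleCat.{0} Λ) b).obj (M.X b) ⟶ M :=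
      HomologicalComplex.mkHomFromSingle (𝟙 _) fun k hk =>
        (M.isZero_of_isStrictlyLE b k (by simp at hk; lia)).eq_of_tgt _ _
    have hι : IsIso (ι.f b) := by
      dsimp only [ι]
      rw [HomologicalComplex.mkHomFromSingle_f, Category.comp_id]
      exact (HomologicalComplex.singleObjXSelf _ _ _).isIso_hom
    have hι' (i : ℤ) : Mono (ι.f i) := by
      by_cases h : i = b
      · subst h; infer_instance
      · exact (HomologicalComplex.isZero_single_obj_X _ _ _ _ h).mono _
    have : Mono ι := HomologicalComplex.mono_of_mono_f _ hι'
    let S : ShortComplex (CochainComplex (ModuleCat.{0} Λ) ℤ) :=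
      ShortComplex.mk ι (cokernel.π ι) (cokernel.condition ι)
    have hS : S.ShortExact :=
      { exact := ShortComplex.exact_of_g_is_cokernel _ (cokernelIsCokernel ι) }
    have hSi (i : ℤ) : Epi ((cokernel.π ι).f i) := inferInstance
    refine IsCompactGE.of_distinguished _ (triangleOfSES_distinguished hS) n
      (isCompactGE_single (M.X b) b n) (ih (cokernel ι) (fun i => ?_) (b - 1) ?_ ?_)
    · exact Module.Finite.of_surjective ((cokernel.π ι).f i).hom
        ((ModuleCat.epi_iff_surjective _).1 (hSi i))
    · rw [CochainComplex.isStrictlyLE_iff]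
      intro i hi
      rw [IsZero.iff_id_eq_zero, ← cancel_epi ((cokernel.π ι).f i), comp_zero, Category.comp_id]
      by_cases h : i = b
      · subst h
        rw [← cancel_epi (ι.f i), comp_zero, ← HomologicalComplex.comp_f, cokernel.condition]
        rfl
      · exact (M.isZero_of_isStrictlyLE b i (by lia)).eq_of_src _ _
    · push_cast at hd; lia

lemma IsDbObject.isDminusObject {C : DerivedCategory (ModuleCat.{0} Λ)} (h : IsDbObject Λ C) :
    IsDminusObject Λ C := by
  obtain ⟨M, ⟨a, b, hM⟩, hfin, e⟩ := h
  exact ⟨M, ⟨b, fun n hn => hM n (Or.inr hn)⟩, hfin, e⟩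

lemma IsDbObject.exists_isGE {C : DerivedCategory (ModuleCat.{0} Λ)} (h : IsDbObject Λ C) :
    ∃ a : ℤ, C.IsGE a := by
  obtain ⟨M, ⟨a, b, hM⟩, -, ⟨e⟩⟩ := h
  have : M.IsStrictlyGE a := (M.isStrictlyGE_iff a).2 fun i hi => hM i (Or.inl hi)
  exact ⟨a, TStructure.t.isGE_of_iso e a⟩

lemma IsDminusObject.exists_isLE {C : DerivedCategory (ModuleCat.{0} Λ)}
    (h : IsDminusObject Λ C) : ∃ b : ℤ, C.IsLE b := by
  obtain ⟨M, ⟨b, hM⟩, -, ⟨e⟩⟩ := h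
  have : M.IsStrictlyLE b := (M.isStrictlyLE_iff b).2 hM
  exact ⟨b, TStructure.t.isLE_of_iso e b⟩

lemma IsDminusObject.shift {C : DerivedCategory (ModuleCat.{0} Λ)} (h : IsDminusObject Λ C)
    (n : ℤ) : IsDminusObject Λ (C⟦n⟧) := by
  obtain ⟨M, ⟨b, hM⟩, hfin, ⟨e⟩⟩ := h
  exact ⟨M⟦n⟧, ⟨b - n, fun i hi => hM (i + n) (by lia)⟩, fun i => hfin (i + n),
    ⟨(Q.commShiftIso n).app M ≪≫ (shiftFunctor _ n).mapIso e⟩⟩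

lemma IsDminusObject.isCompactGE [IsNoetherianRing Λ] {C : DerivedCategory (ModuleCat.{0} Λ)}
    (h : IsDminusObject Λ C) (n : ℤ) : IsCompactGE C n := by
  obtain ⟨M, ⟨b, hM⟩, hfin, ⟨e⟩⟩ := h
  exact (isCompactGE_of_isStrictlyLE M hfin b n ((M.isStrictlyLE_iff b).2 hM)).of_iso e

/-- An object of `D^-(mod Λ)` without nonzero morphisms to `D^b(mod Λ)` vanishes. -/
lemma IsDminusObject.isZero {C : DerivedCategory (ModuleCat.{0} Λ)} (hC : IsDminusObject Λ C)
    (h : ∀ Y, IsDbObject Λ Y → ∀ f : C ⟶ Y, f = 0) : IsZero C := by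
  obtain ⟨b, hb⟩ := hC.exists_isLE
  suffices C.IsGE (b + 1) by
    rw [IsZero.iff_id_eq_zero]
    exact TStructure.t.zero _ b (b + 1) (by lia)
  rw [isGE_iff]
  intro i _
  obtain ⟨M, ⟨c, hM⟩, hfin, ⟨e⟩⟩ := hC
  have hepi (n : ℤ) : Epi ((M.πTruncGE i).f n) :=
    inferInstanceAs (Epi ((HomologicalComplex.πTruncGE M (ComplexShape.embeddingUpIntGE i)).f n))
  have hY : IsDbObject Λ (Q.obj (M.truncGE i)) := by
    refine ⟨M.truncGE i, ⟨i, c, fun n hn => ?_⟩, fun n => ?_, ⟨Iso.refl _⟩⟩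
    · rcases hn with hn | hn
      · exact (M.truncGE i).isZero_of_isStrictlyGE i n hn
      · rw [IsZero.iff_id_eq_zero, ← cancel_epi ((M.πTruncGE i).f n)]
        exact (hM n hn).eq_of_src _ _
    · exact Module.Finite.of_surjective ((M.πTruncGE i).f n).hom
        ((ModuleCat.epi_iff_surjective _).1 (hepi n))
  have h0 : Q.map (M.πTruncGE i) = 0 := by
    rw [← cancel_epi e.inv, comp_zero]
    exact h _ hY _
  have hiso : IsIso ((homologyFunctor _ i).map (Q.map (M.πTruncGE i))) := by
    have : QuasiIsoAt (M.πTruncGE i) i := inferInstance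
    rw [quasiIsoAt_iff_isIso_homologyMap] at this
    exact (NatIso.isIso_map_iff (homologyFunctorFactors (ModuleCat.{0} Λ) i) _).2 this
  rw [h0, Functor.map_zero] at hiso
  exact ((IsZero.iff_id_eq_zero _).2 (isIsoZeroEquiv _ _ hiso).1).of_iso
    ((homologyFunctor _ i).mapIso e.symm)

lemma ThickMem.hom_eq_zero {D : Type*} [Category* D] [Preadditive D] [HasZeroObject D]
    [HasShift D ℤ] [∀ n : ℤ, (shiftFunctor D n).Additive] [Pretriangulated D] {S : Set D} {C Y : D}
    (h : ∀ X ∈ S, ∀ (m : ℤ) (f : C ⟶ X⟦m⟧), f = 0) (hY : ThickMem S Y) (m : ℤ)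
    (f : C ⟶ Y⟦m⟧) : f = 0 := by
  induction hY generalizing m with
  | of X hX => exact h X hX m f
  | zero => exact ((shiftFunctor D m).map_isZero (isZero_zero D)).eq_of_tgt _ _
  | iso e _ ih =>
    rw [← cancel_mono ((shiftFunctor D m).map e.inv), zero_comp]
    exact ih m _
  | shift X n _ ih =>
    rw [← cancel_mono ((shiftFunctorAdd D n m).inv.app X), zero_comp]
    exact ih (n + m) _
  | ext T hT _ _ ih₁ ih₃ =>
    obtain ⟨g, hg⟩ := Triangle.coyoneda_exact₂ _ (Triangle.shift_distinguished T hT m) f (ih₃ m _)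
    exact hg.trans ((congrArg (· ≫ _) (ih₁ m g)).trans zero_comp)
  | summand i p hip _ ih =>
    rw [← Category.comp_id f, ← (shiftFunctor D m).map_id, ← hip, Functor.map_comp,
      ← Category.assoc, ih m (f ≫ _), zero_comp]

lemma nonempty_isColimit_cofan_reindex {D : Type*} [Category* D] {J J' : Type*} (e : J' ≃ J)
    {Y : J → D} {Z : D} {inc : ∀ j, Y j ⟶ Z} (hZ : IsColimit (Cofan.mk Z inc)) :
    Nonempty (IsColimit (Cofan.mk Z fun k => inc (e k))) :=
  ⟨(IsColimit.whiskerEquivalenceEquiv (Discrete.equivalence e) hZ).ofIsoColimit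
    (Cocone.ext (Iso.refl _))⟩

lemma isGE_of_isColimit_of_small {J : Type*} [Small.{0} J]
    {Y : J → DerivedCategory (ModuleCat.{0} Λ)} {Z : DerivedCategory (ModuleCat.{0} Λ)}
    {inc : ∀ j, Y j ⟶ Z} (hZ : IsColimit (Cofan.mk Z inc)) (n : ℤ) (hY : ∀ j, (Y j).IsGE n) :
    Z.IsGE n :=
  isGE_of_isColimit _ n (fun k => hY ((equivShrink J).symm k)) Z _
    (nonempty_isColimit_cofan_reindex (equivShrink J).symm hZ).some

lemma IsCompactGE.hom_eq_zero_of_isColimit {C : DerivedCategory (ModuleCat.{0} Λ)} {n : ℤ}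
    (hC : IsCompactGE C n) {J : Type*} [Small.{0} J]
    {Y : J → DerivedCategory (ModuleCat.{0} Λ)} {Z : DerivedCategory (ModuleCat.{0} Λ)}
    {inc : ∀ j, Y j ⟶ Z} (hZ : IsColimit (Cofan.mk Z inc)) (hY : ∀ j, (Y j).IsGE n)
    (h : ∀ j (f : C ⟶ Y j), f = 0) (f : C ⟶ Z) : f = 0 := by
  obtain ⟨F, g, hg⟩ := hC.exists_sum _ Z _
    (nonempty_isColimit_cofan_reindex (equivShrink J).symm hZ).some (fun k => hY _) f
  rw [hg]
  exact Finset.sum_eq_zero fun k _ => by rw [h _ (g k), zero_comp]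

/-- A morphism to the first term of a sequence which vanishes in the Milnor colimit, witnessed by a
finite sum, is zero if composition with the transition morphisms is injective. -/
lemma eq_zero_of_comp_eq_sum_comp {D : Type*} [Category* D] [Preadditive D] {Y : ℕ → D}
    {β : ∀ n, Y n ⟶ Y (n + 1)} {A P : D} {inc : ∀ n, Y n ⟶ P} (hP : IsColimit (Cofan.mk P inc))
    {s : P ⟶ P} (hs : ∀ n, inc n ≫ s = inc n - β n ≫ inc (n + 1))
    (hβ : ∀ n (f : A ⟶ Y n), f ≫ β n = 0 → f = 0) (f : A ⟶ Y 0) (F : Finset ℕ)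
    (g : ∀ n, A ⟶ Y n) (h : f ≫ inc 0 = (∑ k ∈ F, g k ≫ inc k) ≫ s) : f = 0 := by
  classical
  obtain ⟨N, hN⟩ := F.exists_nat_subset_range
  obtain ⟨g, hgN, h⟩ : ∃ g : ∀ n, A ⟶ Y n, g N = 0 ∧
      f ≫ inc 0 = (∑ k ∈ Finset.range N, g k ≫ inc k) ≫ s := by
    refine ⟨fun k => if k ∈ F then g k else 0, if_neg fun hNF => by simpa using hN hNF, ?_⟩
    rw [h, ← Finset.sum_subset hN fun k _ hk => by simp only [if_neg hk, zero_comp]]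
    exact congrArg (· ≫ s) (Finset.sum_congr rfl fun k hk => by simp only [if_pos hk])
  let d : ∀ n, A ⟶ Y n
    | 0 => g 0 - f
    | n + 1 => g (n + 1) - g n ≫ β n
  have hd : ∑ k ∈ Finset.range (N + 1), d k ≫ inc k = 0 := by
    have hshift : ∑ k ∈ Finset.range N, g k ≫ inc k =
        ∑ k ∈ Finset.range N, g (k + 1) ≫ inc (k + 1) + g 0 ≫ inc 0 := by
      rw [← Finset.sum_range_succ' (fun k => g k ≫ inc k), Finset.sum_range_succ, hgN, zero_comp,
        add_zero]
    simp only [Preadditive.sum_comp, Category.assoc, hs, Preadditive.comp_sub,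
      Finset.sum_sub_distrib] at h
    rw [hshift] at h
    rw [Finset.sum_range_succ']
    simp only [d, Preadditive.sub_comp, Finset.sum_sub_distrib, Category.assoc, h]
    abel
  have hd' (k : ℕ) (hk : k < N + 1) : d k = 0 :=
    eq_zero_of_sum_comp_eq_zero inc hP _ d hd (Finset.mem_range.2 hk)
  have hg (k : ℕ) (hk : k ≤ N) : g k = 0 := by
    induction hk using Nat.decreasingInduction with
    | self => exact hgN
    | of_succ k hk ih =>
      have := hd' (k + 1) (by lia)
      rw [show d (k + 1) = g (k + 1) - g k ≫ β k from rfl, ih, zero_sub, neg_eq_zero] at this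
      exact hβ k _ this
  have := hd' 0 (by lia)
  rwa [show d 0 = g 0 - f from rfl, hg 0 (by lia), zero_sub, neg_eq_zero] at this

lemma isGE_shift_of_neg {C : DerivedCategory (ModuleCat.{0} Λ)} {a : ℤ} (hC : C.IsGE a)
    {m : ℤ} (hm : m < 0) : (C⟦m⟧).IsGE (a + 1) := by
  have := TStructure.t.isGE_shift C a m (a - m) (by lia)
  exact TStructure.t.isGE_of_ge _ (a + 1) (a - m) (by lia)

section Rickard

variable {K : Type} [Field K] [CategoryTheory.Linear K (DerivedCategory (ModuleCat.{0} Λ))]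
  {r : ℕ} {X : Fin r → DerivedCategory (ModuleCat.{0} Λ)}

namespace RickardData

lemma small_index [IsNoetherianRing Λ] (R : RickardData K r X) {a : ℤ}
    (hX : ∀ j, IsDminusObject Λ (X j)) (i : Fin r) (n : ℕ) (hn : (R.Xs i n).IsGE a) :
    Small.{0} (Σ (j : Fin r) (m : ℤ), {f : (X j)⟦m⟧ ⟶ R.Xs i n // m < 0 ∧ f ∈ R.B j m i n}) := by
  have (j : Fin r) (m : ℤ) : Small.{0} ((X j)⟦m⟧ ⟶ R.Xs i n) :=
    (((hX j).shift m).isCompactGE a).small _ hn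
  infer_instance

lemma isGE_Xs [IsNoetherianRing Λ] (R : RickardData K r X) {a : ℤ}
    (hX : ∀ j, IsDminusObject Λ (X j)) (ha : ∀ j, (X j).IsGE a) (i : Fin r) (n : ℕ) :
    (R.Xs i n).IsGE a := by
  induction n with
  | zero => rw [R.Xs_zero]; exact ha i
  | succ n ih =>
    have := R.small_index hX i n ih
    have := isGE_of_isColimit_of_small (R.isColimitZ i n).some (a + 1)
      fun p => isGE_shift_of_neg (ha p.1) p.2.2.2.1
    exact TStructure.t.isGE₂ _ (rot_of_distTriang _ (R.dist i n)) a ih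
      (TStructure.t.isGE_shift (R.Z i n) (a + 1) 1 a (by lia))

lemma eq_zero_of_comp_β_eq_zero [IsNoetherianRing Λ] (R : RickardData K r X) {a : ℤ}
    (hX : ∀ j, IsDminusObject Λ (X j)) (ha : ∀ j, (X j).IsGE a)
    {C : DerivedCategory (ModuleCat.{0} Λ)} (hC : IsDminusObject Λ C)
    (h : ∀ j (m : ℤ), m < 0 → ∀ f : C ⟶ (X j)⟦m⟧, f = 0) (i : Fin r) (n : ℕ)
    (f : C ⟶ R.Xs i n) (hf : f ≫ R.β i n = 0) : f = 0 := by
  have := R.small_index hX i n (R.isGE_Xs hX ha i n)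
  obtain ⟨g, hg⟩ := Triangle.coyoneda_exact₂ _ (R.dist i n) f hf
  have : g = 0 := (hC.isCompactGE (a + 1)).hom_eq_zero_of_isColimit
    (R.isColimitZ i n).some (fun p => isGE_shift_of_neg (ha p.1) p.2.2.2.1)
    (fun p => h p.1 p.2.1 p.2.2.2.1) g
  exact hg.trans ((congrArg (· ≫ _) this).trans zero_comp)

lemma hom_eq_zero [IsNoetherianRing Λ] (R : RickardData K r X) {a : ℤ}
    (hX : ∀ j, IsDminusObject Λ (X j)) (ha : ∀ j, (X j).IsGE a)
    {C : DerivedCategory (ModuleCat.{0} Λ)} (hC : IsDminusObject Λ C)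
    (h : ∀ j (m : ℤ), m < 0 → ∀ f : C ⟶ (X j)⟦m⟧, f = 0) (i : Fin r)
    (hT : ∀ f : C ⟶ R.T i, f = 0) :
    ∀ f : C ⟶ X i, f = 0 := by
  rw [← R.Xs_zero i]
  intro f
  obtain ⟨g, hg⟩ := Triangle.coyoneda_exact₂ _ (R.distT i) (f ≫ R.cinc i 0) (hT _)
  obtain ⟨F, c, hc⟩ := (hC.isCompactGE a).exists_sum _ _ _ (R.isColimitCP i).some
    (R.isGE_Xs hX ha i) g
  exact eq_zero_of_comp_eq_sum_comp (R.isColimitCP i).some (R.cinc_oneSubβ i)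
    (R.eq_zero_of_comp_β_eq_zero hX ha hC h i) f F c (hg.trans (congrArg (· ≫ _) hc))

end RickardData

end Rickard

lemma forall_hom_shift_eq_zero_iff {D : Type*} [Category* D] [Preadditive D] [HasShift D ℤ]
    [∀ n : ℤ, (shiftFunctor D n).Additive] (A Y : D) (m n p : ℤ) (h : m + n = p) :
    (∀ f : A⟦n⟧ ⟶ Y⟦p⟧, f = 0) ↔ ∀ f : A ⟶ Y⟦m⟧, f = 0 := by
  constructor
  · intro H f
    apply (shiftFunctor D n).map_injective
    rw [Functor.map_zero, ← cancel_mono ((shiftFunctorAdd' D m n p h).inv.app Y), zero_comp]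
    exact H _
  · intro H f
    obtain ⟨g, hg⟩ := (shiftFunctor D n).map_surjective
      (f ≫ (shiftFunctorAdd' D m n p h).hom.app Y)
    rw [← cancel_mono ((shiftFunctorAdd' D m n p h).hom.app Y), zero_comp, ← hg, H g,
      Functor.map_zero]

end Compact

/-- **Lemma 5.8 of Rickard's construction** (Lemma `L:T` c)).
If `C ∈ D^-(mod Λ)` satisfies `Hom(C, Σ^m T_i) = 0` for all `m ∈ ℤ` and all
`1 ≤ i ≤ r`, then `C = 0`. -/
theorem rickardT_cogenerates
    (K : Type) [Field K] [IsAlgClosed K]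
    (Λ : Type) [Ring Λ] [Algebra K Λ] [FiniteDimensional K Λ]
    (hbasic : IsBasicAlgebra K Λ)
    [HasDerivedCategory (ModuleCat.{0} Λ)]
    [CategoryTheory.Linear K (DerivedCategory (ModuleCat.{0} Λ))]
    [(DerivedCategory.Qh (C := ModuleCat.{0} Λ)).Linear K]
    (r : ℕ) (hr : IsCompleteFamilyOfSimples Λ r)
    (X : Fin r → DerivedCategory (ModuleCat.{0} Λ))
    (hX : IsSimpleMindedCollection K Λ r X)
    (R : RickardData K r X)
    (C : DerivedCategory (ModuleCat.{0} Λ)) (hC : IsDminusObject Λ C)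
    (hvanish : ∀ (i : Fin r) (m : ℤ) (f : C ⟶ (R.T i)⟦m⟧), f = 0) :
    IsZero C := by
  have : IsNoetherianRing Λ := isNoetherian_of_tower K inferInstance
  have hXm (j : Fin r) := (hX.mem_Db j).isDminusObject
  obtain ⟨b, hb⟩ := hC.exists_isLE
  obtain ⟨a, ha⟩ : ∃ a : ℤ, ∀ j, (X j).IsGE a := by
    choose a ha using fun j => (hX.mem_Db j).exists_isGE
    obtain ⟨c, hc⟩ := (Set.finite_range a).bddBelow
    exact ⟨c, fun j => DerivedCategory.TStructure.t.isGE_of_ge _ c (a j) (hc ⟨j, rfl⟩)⟩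
  have key (d : ℕ) : ∀ j (m : ℤ), m < a - b + d → ∀ f : C ⟶ (X j)⟦m⟧, f = 0 := by
    induction d with
    | zero =>
      intro j m hm f
      have := DerivedCategory.TStructure.t.isGE_shift (X j) a m (a - m)
      exact DerivedCategory.TStructure.t.zero f b (a - m) (by lia)
    | succ d ih =>
      intro j m hm
      rw [← forall_hom_shift_eq_zero_iff C (X j) m (-m) 0 (by lia)]
      intro f
      rw [← cancel_mono ((shiftFunctorZero _ ℤ).hom.app (X j)), zero_comp]
      refine R.hom_eq_zero hXm ha (hC.shift (-m)) (fun k l hl => ?_) j (fun g => ?_) _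
      · rw [forall_hom_shift_eq_zero_iff C (X k) (l + m) (-m) l (by lia)]
        exact ih k (l + m) (by push_cast at hm; lia)
      · rw [← cancel_mono ((shiftFunctorZero _ ℤ).inv.app (R.T j)), zero_comp]
        exact (forall_hom_shift_eq_zero_iff C (R.T j) m (-m) 0 (by lia)).2 (hvanish j m) _
  refine hC.isZero fun Y hY f => ?_
  rw [← cancel_mono ((shiftFunctorZero _ ℤ).inv.app Y), zero_comp]
  refine ThickMem.hom_eq_zero ?_ ((hX.generates Y).1 hY) 0 _
  rintro _ ⟨j, rfl⟩ m
  exact key (m - (a - b) + 1).toNat j m (by lia)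

end RickardKoenigYang
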